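/- arXiv:1609.09701 — 4 statements merged into one kernel-verified Lean document; each statement's English description precedes it below -/
import Mathlib

section
/- Let F and H be filtrations on (Ω, 𝒜, P), let X = (X¹, …, Xᵐ) be F-adapted with each Xⁱ_t P-integrable and Y = (Y¹, …, Yⁿ) be H-adapted with each Yʲ_t P-integrable. Assume there is a probability measure P^X on (Ω, F_T) equivalent to P|_{F_T} under which every Xⁱ is an F-martingale, and a probability measure P^Y on (Ω, H_T) equivalent to P|_{H_T} under which every Yʲ is an H-martingale, and assume the σ-algebras F_T and H_T are P-independent. Let L^X = dP^X/d(P|_{F_T}) and L^Y = dP^Y/d(P|_{H_T}) be the Radon–Nikodym derivatives, and define the measure Q on (Ω, G_T), where G = F ∨ H, by dQ/d(P|_{G_T}) = L^X · L^Y. Then: Q is a probability measure equivalent to P|_{G_T}; F_T and H_T are Q-independent; Q coincides with P^X on F_T and with P^Y on H_T; every Xⁱ and every Yʲ is a (Q, G)-martingale; and for all i, j the product process (Xⁱ_t Yʲ_t)_{t∈[0,T]} is a (Q, G)-martingale. -/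
open MeasureTheory Set ENNReal

noncomputable section

/-- `M` is a martingale on the time interval `[0, T]` with respect to the filtration `F`
and the measure `P` (the ambient σ-algebra being the `MeasurableSpace` instance on `Ω`). -/
def IsMartingaleOn {Ω : Type*} [mΩ : MeasurableSpace Ω] (P : Measure Ω)
    (F : ℝ → MeasurableSpace Ω) (T : ℝ) (M : ℝ → Ω → ℝ) : Prop :=
  (∀ t, t ∈ Set.Icc (0 : ℝ) T → StronglyMeasurable[F t] (M t) ∧ Integrable (M t) P) ∧
    ∀ s t, s ∈ Set.Icc (0 : ℝ) T → t ∈ Set.Icc (0 : ℝ) T → s ≤ t →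
      P[M t | F s] =ᵐ[P] M s

theorem withDensity_trim_apply {Ω : Type*} {a m0 : MeasurableSpace Ω} (P : Measure Ω)
    (ha : a ≤ m0) {L : Ω → ℝ≥0∞} (hL : Measurable[a] L) {A : Set Ω} (hA : MeasurableSet[a] A) :
    (P.trim ha).withDensity L A = ∫⁻ ω, A.indicator L ω ∂P := by
  rw [withDensity_apply _ hA, ← lintegral_indicator hA, lintegral_trim ha (hL.indicator hA)]

theorem withDensity_mul_trim_inter {Ω : Type*} {a b m0 : MeasurableSpace Ω} (P : Measure Ω)
    (ha : a ≤ m0) (hb : b ≤ m0) (hab : ProbabilityTheory.Indep a b P) {L K : Ω → ℝ≥0∞}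
    (hL : Measurable[a] L) (hK : Measurable[b] K) {A B : Set Ω}
    (hA : MeasurableSet[a] A) (hB : MeasurableSet[b] B) :
    (P.trim (sup_le ha hb)).withDensity (fun ω => L ω * K ω) (A ∩ B) =
      (P.trim ha).withDensity L A * (P.trim hb).withDensity K B := by
  have hL' : Measurable[a ⊔ b] L := hL.mono le_sup_left le_rfl
  have hK' : Measurable[a ⊔ b] K := hK.mono le_sup_right le_rfl
  have hA' : MeasurableSet[a ⊔ b] A := (le_sup_left : a ≤ a ⊔ b) A hA
  have hB' : MeasurableSet[a ⊔ b] B := (le_sup_right : b ≤ a ⊔ b) B hB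
  have hLK : Measurable[a ⊔ b] (fun ω => L ω * K ω) := hL'.mul hK'
  rw [withDensity_trim_apply P (sup_le ha hb) hLK (hA'.inter hB'),
    withDensity_trim_apply P ha hL hA, withDensity_trim_apply P hb hK hB,
    ← ProbabilityTheory.lintegral_mul_eq_lintegral_mul_lintegral_of_independent_measurableSpace
      ha hb hab (hL.indicator hA) (hK.indicator hB)]
  simp_rw [Set.inter_indicator_mul]

theorem trim_ae_ne_zero_of_absolutelyContinuous {Ω : Type*} {a m0 : MeasurableSpace Ω}
    {P : Measure Ω} (ha : a ≤ m0) {L : Ω → ℝ≥0∞} (hL : Measurable[a] L)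
    (hac : P.trim ha ≪ (P.trim ha).withDensity L) : ∀ᵐ ω ∂P, L ω ≠ 0 := by
  exact ae_of_ae_trim ha (hac.ae_le ((ae_withDensity_iff hL).2 (ae_of_all _ fun _ h => h)))

theorem setIntegral_eq_of_isMartingaleOn_trim {Ω : Type*} {a m : MeasurableSpace Ω}
    {Q : Measure Ω} [IsFiniteMeasure Q] (ha : a ≤ m) {F : ℝ → MeasurableSpace Ω} {T : ℝ}
    (hF : ∀ t ∈ Icc (0 : ℝ) T, F t ≤ a) {M : ℝ → Ω → ℝ}
    (hM : IsMartingaleOn (mΩ := a) (Q.trim ha) F T M) {s t : ℝ} (hs : s ∈ Icc (0 : ℝ) T)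
    (ht : t ∈ Icc (0 : ℝ) T) (hst : s ≤ t) {A : Set Ω} (hA : MeasurableSet[F s] A) :
    ∫ ω in A, M t ω ∂Q = ∫ ω in A, M s ω ∂Q := by
  have hA' : MeasurableSet[a] A := hF s hs A hA
  rw [setIntegral_trim ha ((hM.1 t ht).1.mono (hF t ht)) hA',
    setIntegral_trim ha ((hM.1 s hs).1.mono (hF s hs)) hA',
    ← setIntegral_condExp (hF s hs) (hM.1 t ht).2 hA]
  exact integral_congr_ae (ae_restrict_of_ae (hM.2 s t hs ht hst))

theorem setIntegral_inter_mul_of_indep {Ω : Type*} {a b m : MeasurableSpace Ω} {Q : Measure Ω}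
    (ha : a ≤ m) (hb : b ≤ m) (hab : ProbabilityTheory.Indep a b Q)
    {U V : Ω → ℝ} (hU : StronglyMeasurable[a] U) (hV : StronglyMeasurable[b] V) {A B : Set Ω}
    (hA : MeasurableSet[a] A) (hB : MeasurableSet[b] B) :
    ∫ ω in A ∩ B, U ω * V ω ∂Q = (∫ ω in A, U ω ∂Q) * ∫ ω in B, V ω ∂Q := by
  have hUA := hU.indicator hA
  have hVB := hV.indicator hB
  have hind : ProbabilityTheory.IndepFun (A.indicator U) (B.indicator V) Q :=
    ProbabilityTheory.indep_of_indep_of_le_left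
      (ProbabilityTheory.indep_of_indep_of_le_right hab hVB.measurable.comap_le)
      hUA.measurable.comap_le
  rw [← integral_indicator ((ha A hA).inter (hb B hB)), ← integral_indicator (ha A hA),
    ← integral_indicator (hb B hB), ← hind.integral_fun_mul_eq_mul_integral
      (hUA.mono ha).aestronglyMeasurable (hVB.mono hb).aestronglyMeasurable]
  simp_rw [Set.inter_indicator_mul]

theorem sup_eq_generateFrom_inter {Ω : Type*} (a b : MeasurableSpace Ω) :
    a ⊔ b = MeasurableSpace.generateFrom
      {S | ∃ A, MeasurableSet[a] A ∧ ∃ B, MeasurableSet[b] B ∧ A ∩ B = S} := by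
  refine le_antisymm (sup_le (fun A hA => ?_) fun B hB => ?_)
    (MeasurableSpace.generateFrom_le ?_)
  · exact MeasurableSpace.measurableSet_generateFrom
      ⟨A, hA, univ, MeasurableSet.univ, inter_univ A⟩
  · exact MeasurableSpace.measurableSet_generateFrom
      ⟨univ, MeasurableSet.univ, B, hB, univ_inter B⟩
  · rintro _ ⟨A, hA, B, hB, rfl⟩
    exact MeasurableSet.inter ((le_sup_left : a ≤ a ⊔ b) A hA) ((le_sup_right : b ≤ a ⊔ b) B hB)

theorem isPiSystem_inter {Ω : Type*} (a b : MeasurableSpace Ω) :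
    IsPiSystem {S : Set Ω | ∃ A, MeasurableSet[a] A ∧ ∃ B, MeasurableSet[b] B ∧ A ∩ B = S} := by
  rintro _ ⟨A, hA, B, hB, rfl⟩ _ ⟨A', hA', B', hB', rfl⟩ _
  exact ⟨A ∩ A', hA.inter hA', B ∩ B', hB.inter hB', inter_inter_inter_comm A A' B B'⟩

/-- Conditional expectations of products factorize along independent σ-algebras. -/
theorem condExp_mul_sup_of_indep {Ω : Type*} {a a' b b' m : MeasurableSpace Ω} {Q : Measure Ω}
    [IsFiniteMeasure Q] (ha : a ≤ m) (hb : b ≤ m) (ha' : a' ≤ a) (hb' : b' ≤ b)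
    (hab : ProbabilityTheory.Indep a b Q) {U U' V V' : Ω → ℝ}
    (hU : StronglyMeasurable[a] U) (hU' : StronglyMeasurable[a'] U')
    (hV : StronglyMeasurable[b] V) (hV' : StronglyMeasurable[b'] V')
    (hUV : Integrable (fun ω => U ω * V ω) Q) (hUV' : Integrable (fun ω => U' ω * V' ω) Q)
    (hUU' : ∀ A, MeasurableSet[a'] A → ∫ ω in A, U ω ∂Q = ∫ ω in A, U' ω ∂Q)
    (hVV' : ∀ B, MeasurableSet[b'] B → ∫ ω in B, V ω ∂Q = ∫ ω in B, V' ω ∂Q) :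
    Q[fun ω => U ω * V ω | a' ⊔ b'] =ᵐ[Q] fun ω => U' ω * V' ω := by
  have hle : a' ⊔ b' ≤ m := sup_le (ha'.trans ha) (hb'.trans hb)
  symm
  refine ae_eq_condExp_of_forall_setIntegral_eq hle hUV (fun _ _ _ => hUV'.integrableOn) ?_
    ((hU'.mono le_sup_left).mul (hV'.mono le_sup_right)).aestronglyMeasurable
  have key : ∀ A B, MeasurableSet[a'] A → MeasurableSet[b'] B →
      ∫ ω in A ∩ B, U' ω * V' ω ∂Q = ∫ ω in A ∩ B, U ω * V ω ∂Q := fun A B hA hB => by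
    rw [setIntegral_inter_mul_of_indep ha hb hab (hU'.mono ha') (hV'.mono hb')
        (ha' A hA) (hb' B hB),
      setIntegral_inter_mul_of_indep ha hb hab hU hV (ha' A hA) (hb' B hB), hUU' A hA, hVV' B hB]
  have huniv : ∫ ω, U' ω * V' ω ∂Q = ∫ ω, U ω * V ω ∂Q := by
    simpa using key univ univ MeasurableSet.univ MeasurableSet.univ
  intro S hS _
  induction S, hS using MeasurableSpace.induction_on_inter
      (sup_eq_generateFrom_inter a' b') (isPiSystem_inter a' b') with
  | empty => simp
  | basic S hS =>
    obtain ⟨A, hA, B, hB, rfl⟩ := hS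
    exact key A B hA hB
  | compl S hS ih =>
    have h1 := integral_add_compl (hle S hS) hUV
    have h2 := integral_add_compl (hle S hS) hUV'
    have h3 := ih (measure_lt_top Q S)
    linarith
  | iUnion f hd hf ih =>
    rw [integral_iUnion (fun i => hle _ (hf i)) hd hUV.integrableOn,
      integral_iUnion (fun i => hle _ (hf i)) hd hUV'.integrableOn]
    exact tsum_congr fun i => ih i (measure_lt_top Q _)

theorem IsMartingaleOn.mul_of_indep {Ω : Type*} {a b m : MeasurableSpace Ω} {Q : Measure Ω}
    [IsFiniteMeasure Q] (ha : a ≤ m) (hb : b ≤ m) (hab : ProbabilityTheory.Indep a b Q)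
    {F H : ℝ → MeasurableSpace Ω} {T : ℝ} (hF : ∀ t ∈ Icc (0 : ℝ) T, F t ≤ a)
    (hH : ∀ t ∈ Icc (0 : ℝ) T, H t ≤ b) {M N : ℝ → Ω → ℝ}
    (hM : IsMartingaleOn (mΩ := a) (Q.trim ha) F T M)
    (hN : IsMartingaleOn (mΩ := b) (Q.trim hb) H T N) :
    IsMartingaleOn Q (fun t => F t ⊔ H t) T (fun t ω => M t ω * N t ω) := by
  have hint : ∀ t ∈ Icc (0 : ℝ) T, Integrable (fun ω => M t ω * N t ω) Q := fun t ht => by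
    have hind : ProbabilityTheory.IndepFun (M t) (N t) Q :=
      ProbabilityTheory.indep_of_indep_of_le_left
        (ProbabilityTheory.indep_of_indep_of_le_right hab
          ((hN.1 t ht).1.mono (hH t ht)).measurable.comap_le)
        ((hM.1 t ht).1.mono (hF t ht)).measurable.comap_le
    exact hind.integrable_mul (integrable_of_integrable_trim ha (hM.1 t ht).2)
      (integrable_of_integrable_trim hb (hN.1 t ht).2)
  refine ⟨fun t ht => ⟨((hM.1 t ht).1.mono le_sup_left).mul ((hN.1 t ht).1.mono le_sup_right),
    hint t ht⟩, fun s t hs ht hst => ?_⟩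
  exact condExp_mul_sup_of_indep ha hb (hF s hs) (hH s hs) hab
    ((hM.1 t ht).1.mono (hF t ht)) (hM.1 s hs).1 ((hN.1 t ht).1.mono (hH t ht)) (hN.1 s hs).1
    (hint t ht) (hint s hs)
    (fun _ hA => setIntegral_eq_of_isMartingaleOn_trim ha hF hM hs ht hst hA)
    (fun _ hB => setIntegral_eq_of_isMartingaleOn_trim hb hH hN hs ht hst hB)

theorem isMartingaleOn_one {Ω : Type*} {m : MeasurableSpace Ω} {Q : Measure Ω}
    [IsFiniteMeasure Q] {F : ℝ → MeasurableSpace Ω} {T : ℝ}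
    (hF : ∀ t ∈ Icc (0 : ℝ) T, F t ≤ m) : IsMartingaleOn Q F T (fun _ _ => 1) :=
  ⟨fun _ _ => ⟨stronglyMeasurable_const, integrable_const _⟩,
    fun s _ hs _ _ => by rw [condExp_const (hF s hs)]⟩

/-- The decoupling-measure construction of part i4) of Theorem 3.4: with
`dQ/d(P|_{G_T}) = L^X · L^Y`, the measure `Q` is a probability measure equivalent to
`P|_{G_T}`, under which `F_T` and `H_T` are independent; `Q` coincides with `P^X` on `F_T`
and with `P^Y` on `H_T`; every `Xⁱ` and every `Yʲ` is a `(Q, G)`-martingale; and every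
product `Xⁱ Yʲ` is a `(Q, G)`-martingale. -/
theorem stmt_2 {Ω : Type*} [m0 : MeasurableSpace Ω] (P : Measure Ω) [IsProbabilityMeasure P]
    (T : ℝ) (hT : 0 < T)
    (F H : ℝ → MeasurableSpace Ω)
    (hFle : ∀ t, F t ≤ m0) (hHle : ∀ t, H t ≤ m0)
    (hFmono : Monotone F) (hHmono : Monotone H)
    {m n : ℕ} (X : Fin m → ℝ → Ω → ℝ) (Y : Fin n → ℝ → Ω → ℝ)
    -- `X` is `F`-adapted with `P`-integrable components, `Y` is `H`-adapted likewise.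
    (hXad : ∀ i, ∀ t ∈ Set.Icc (0 : ℝ) T, StronglyMeasurable[F t] (X i t))
    (hXint : ∀ i, ∀ t ∈ Set.Icc (0 : ℝ) T, Integrable (X i t) P)
    (hYad : ∀ j, ∀ t ∈ Set.Icc (0 : ℝ) T, StronglyMeasurable[H t] (Y j t))
    (hYint : ∀ j, ∀ t ∈ Set.Icc (0 : ℝ) T, Integrable (Y j t) P)
    -- `P^X` : a probability measure on `(Ω, F_T)` equivalent to `P|_{F_T}` under which every
    -- `Xⁱ` is an `F`-martingale.
    (PX : @Measure Ω (F T)) (hPXprob : IsProbabilityMeasure PX)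
    (hPXac : PX ≪ P.trim (hFle T)) (hacPX : P.trim (hFle T) ≪ PX)
    (hPXmart : ∀ i, IsMartingaleOn (mΩ := F T) PX F T (X i))
    -- `P^Y` : a probability measure on `(Ω, H_T)` equivalent to `P|_{H_T}` under which every
    -- `Yʲ` is an `H`-martingale.
    (PY : @Measure Ω (H T)) (hPYprob : IsProbabilityMeasure PY)
    (hPYac : PY ≪ P.trim (hHle T)) (hacPY : P.trim (hHle T) ≪ PY)
    (hPYmart : ∀ j, IsMartingaleOn (mΩ := H T) PY H T (Y j))
    -- `F_T` and `H_T` are `P`-independent.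
    (hIndep : ∀ A B : Set Ω, MeasurableSet[F T] A → MeasurableSet[H T] B →
      P (A ∩ B) = P A * P B)
    -- `L^X = dP^X/d(P|_{F_T})` and `L^Y = dP^Y/d(P|_{H_T})`.
    (LX LY : Ω → ℝ≥0∞)
    (hLXmeas : Measurable[F T] LX) (hLYmeas : Measurable[H T] LY)
    (hLX : PX = (P.trim (hFle T)).withDensity LX)
    (hLY : PY = (P.trim (hHle T)).withDensity LY)
    -- `Q` : the measure on `(Ω, G_T)` with `dQ/d(P|_{G_T}) = L^X · L^Y`.
    (Q : @Measure Ω (F T ⊔ H T))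
    (hQ : Q = (P.trim (sup_le (hFle T) (hHle T))).withDensity (fun ω => LX ω * LY ω)) :
    IsProbabilityMeasure Q ∧
    Q ≪ P.trim (sup_le (hFle T) (hHle T)) ∧
    P.trim (sup_le (hFle T) (hHle T)) ≪ Q ∧
    (∀ A B : Set Ω, MeasurableSet[F T] A → MeasurableSet[H T] B →
      Q (A ∩ B) = Q A * Q B) ∧
    (∀ A : Set Ω, MeasurableSet[F T] A → Q A = PX A) ∧
    (∀ B : Set Ω, MeasurableSet[H T] B → Q B = PY B) ∧
    (∀ i, IsMartingaleOn (mΩ := F T ⊔ H T) Q (fun t => F t ⊔ H t) T (X i)) ∧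
    (∀ j, IsMartingaleOn (mΩ := F T ⊔ H T) Q (fun t => F t ⊔ H t) T (Y j)) ∧
    (∀ i j, IsMartingaleOn (mΩ := F T ⊔ H T) Q (fun t => F t ⊔ H t) T
      (fun t ω => X i t ω * Y j t ω)) := by
  have hF : ∀ t ∈ Icc (0 : ℝ) T, F t ≤ F T := fun t ht => hFmono ht.2
  have hH : ∀ t ∈ Icc (0 : ℝ) T, H t ≤ H T := fun t ht => hHmono ht.2
  have hind : ProbabilityTheory.Indep (F T) (H T) P :=
    (ProbabilityTheory.Indep_iff _ _ _).2 fun A B => hIndep A B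
  have hprod : ∀ A B : Set Ω, MeasurableSet[F T] A → MeasurableSet[H T] B →
      Q (A ∩ B) = PX A * PY B := fun A B hA hB => by
    rw [hQ, hLX, hLY]
    exact withDensity_mul_trim_inter P (hFle T) (hHle T) hind hLXmeas hLYmeas hA hB
  have hQX : ∀ A : Set Ω, MeasurableSet[F T] A → Q A = PX A := fun A hA => by
    simpa [hPYprob.measure_univ] using hprod A univ hA MeasurableSet.univ
  have hQY : ∀ B : Set Ω, MeasurableSet[H T] B → Q B = PY B := fun B hB => by
    simpa [hPXprob.measure_univ] using hprod univ B MeasurableSet.univ hB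
  have hQindep : ∀ A B : Set Ω, MeasurableSet[F T] A → MeasurableSet[H T] B →
      Q (A ∩ B) = Q A * Q B := fun A B hA hB => by rw [hprod A B hA hB, hQX A hA, hQY B hB]
  have hQprob : IsProbabilityMeasure Q :=
    ⟨by rw [hQX univ MeasurableSet.univ, hPXprob.measure_univ]⟩
  have hLXmeas' : Measurable[F T ⊔ H T] LX := hLXmeas.mono le_sup_left le_rfl
  have hLYmeas' : Measurable[F T ⊔ H T] LY := hLYmeas.mono le_sup_right le_rfl
  have hmul : Measurable[F T ⊔ H T] (fun ω => LX ω * LY ω) := hLXmeas'.mul hLYmeas'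
  have hPQ : P.trim (sup_le (hFle T) (hHle T)) ≪ Q := by
    rw [hQ]
    refine withDensity_absolutelyContinuous' hmul.aemeasurable ?_
    have hX := trim_ae_ne_zero_of_absolutelyContinuous (hFle T) hLXmeas (hLX ▸ hacPX)
    have hY := trim_ae_ne_zero_of_absolutelyContinuous (hHle T) hLYmeas (hLY ▸ hacPY)
    have hset : MeasurableSet[F T ⊔ H T] {ω | ¬ LX ω * LY ω ≠ 0} := by
      simp only [ne_eq, not_not]
      exact hmul (measurableSet_singleton 0)
    rw [ae_iff, trim_measurableSet_eq _ hset, ← ae_iff]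
    filter_upwards [hX, hY] with ω h1 h2 using mul_ne_zero h1 h2
  have hindQ : @ProbabilityTheory.Indep Ω (F T) (H T) (F T ⊔ H T) Q :=
    (ProbabilityTheory.Indep_iff _ _ _).2 hQindep
  have hPXtrim : PX = @Measure.trim Ω (F T) (F T ⊔ H T) Q le_sup_left :=
    @Measure.ext _ (F T) _ _ fun A hA => by rw [trim_measurableSet_eq _ hA, hQX A hA]
  have hPYtrim : PY = @Measure.trim Ω (H T) (F T ⊔ H T) Q le_sup_right :=
    @Measure.ext _ (H T) _ _ fun B hB => by rw [trim_measurableSet_eq _ hB, hQY B hB]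
  have hmart {M N : ℝ → Ω → ℝ} (hM : IsMartingaleOn (mΩ := F T) PX F T M)
      (hN : IsMartingaleOn (mΩ := H T) PY H T N) :
      IsMartingaleOn (mΩ := F T ⊔ H T) Q (fun t => F t ⊔ H t) T (fun t ω => M t ω * N t ω) := by
    rw [hPXtrim] at hM
    rw [hPYtrim] at hN
    exact IsMartingaleOn.mul_of_indep (m := F T ⊔ H T) le_sup_left le_sup_right hindQ hF hH hM hN
  refine ⟨hQprob, hQ ▸ withDensity_absolutelyContinuous _ _, hPQ, hQindep, hQX, hQY,
    fun i => ?_, fun j => ?_, fun i j => hmart (hPXmart i) (hPYmart j)⟩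
  · simpa using hmart (hPXmart i) (isMartingaleOn_one (m := H T) hH)
  · simpa using hmart (isMartingaleOn_one (m := F T) hF) (hPYmart j)
end
end

section
/- Let 𝒻 and ℋ be P-independent sub-σ-algebras of 𝒜, and let 𝒻' ⊆ 𝒻 and ℋ' ⊆ ℋ be sub-σ-algebras. Let X be 𝒻-measurable and P-integrable and Y be ℋ-measurable and P-integrable. Then XY is P-integrable and E^P[XY | 𝒻' ∨ ℋ'] = E^P[X | 𝒻'] · E^P[Y | ℋ'] P-a.s., where 𝒻' ∨ ℋ' is the σ-algebra generated by 𝒻' ∪ ℋ'. -/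
open MeasureTheory Set

noncomputable section

namespace ProbabilityTheory

variable {Ω : Type*} {m m₁ m₂ m₁' m₂' : MeasurableSpace Ω} {P : @Measure Ω m}

theorem Indep.indepFun {X Y : Ω → ℝ} (hind : Indep m₁ m₂ P)
    (hX : StronglyMeasurable[m₁] X) (hY : StronglyMeasurable[m₂] Y) : IndepFun X Y P :=
  indep_of_indep_of_le_left (indep_of_indep_of_le_right hind hY.measurable.comap_le)
    hX.measurable.comap_le

theorem Indep.integrable_mul {X Y : Ω → ℝ} (hind : Indep m₁ m₂ P)
    (hX : StronglyMeasurable[m₁] X) (hXint : Integrable X P)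
    (hY : StronglyMeasurable[m₂] Y) (hYint : Integrable Y P) :
    Integrable (fun ω => X ω * Y ω) P :=
  (hind.indepFun hX hY).integrable_mul hXint hYint

theorem Indep.setIntegral_inter_mul {X Y : Ω → ℝ} {A B : Set Ω} (hle₁ : m₁ ≤ m) (hle₂ : m₂ ≤ m)
    (hind : Indep m₁ m₂ P)
    (hX : StronglyMeasurable[m₁] X) (hY : StronglyMeasurable[m₂] Y)
    (hA : MeasurableSet[m₁] A) (hB : MeasurableSet[m₂] B) :
    ∫ ω in A ∩ B, X ω * Y ω ∂P = (∫ ω in A, X ω ∂P) * ∫ ω in B, Y ω ∂P := by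
  have hXA : StronglyMeasurable[m₁] (A.indicator X) := hX.indicator hA
  have hYB : StronglyMeasurable[m₂] (B.indicator Y) := hY.indicator hB
  rw [← integral_indicator (hle₁ _ hA), ← integral_indicator (hle₂ _ hB),
    ← integral_indicator ((hle₁ _ hA).inter (hle₂ _ hB)),
    ← (hind.indepFun hXA hYB).integral_fun_mul_eq_mul_integral
      (hXA.mono hle₁).aestronglyMeasurable (hYB.mono hle₂).aestronglyMeasurable]
  simp_rw [Set.inter_indicator_mul]

theorem setIntegral_eq_of_forall_inter [IsFiniteMeasure P] {F G : Ω → ℝ}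
    (hle₁ : m₁ ≤ m) (hle₂ : m₂ ≤ m) (hF : Integrable F P) (hG : Integrable G P)
    (hFG : ∀ A B, MeasurableSet[m₁] A → MeasurableSet[m₂] B →
      ∫ ω in A ∩ B, F ω ∂P = ∫ ω in A ∩ B, G ω ∂P)
    {s : Set Ω} (hs : MeasurableSet[m₁ ⊔ m₂] s) :
    ∫ ω in s, F ω ∂P = ∫ ω in s, G ω ∂P := by
  have hle : m₁ ⊔ m₂ ≤ m := sup_le hle₁ hle₂
  have hgen : m₁ ⊔ m₂ = MeasurableSpace.generateFrom
      {s | ∃ A B, MeasurableSet[m₁] A ∧ MeasurableSet[m₂] B ∧ A ∩ B = s} := by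
    refine le_antisymm (sup_le ?_ ?_) (MeasurableSpace.generateFrom_le ?_)
    · exact fun A hA => .basic A ⟨A, univ, hA, .univ, inter_univ A⟩
    · exact fun B hB => .basic B ⟨univ, B, .univ, hB, univ_inter B⟩
    · rintro _ ⟨A, B, hA, hB, rfl⟩
      exact MeasurableSet.inter ((le_sup_left : m₁ ≤ m₁ ⊔ m₂) _ hA)
        ((le_sup_right : m₂ ≤ m₁ ⊔ m₂) _ hB)
  have hpi : IsPiSystem {s | ∃ A B, MeasurableSet[m₁] A ∧ MeasurableSet[m₂] B ∧ A ∩ B = s} := by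
    rintro _ ⟨A, B, hA, hB, rfl⟩ _ ⟨A', B', hA', hB', rfl⟩ -
    exact ⟨A ∩ A', B ∩ B', hA.inter hA', hB.inter hB', inter_inter_inter_comm A A' B B'⟩
  induction s, hs using MeasurableSpace.induction_on_inter hgen hpi with
  | empty => simp
  | basic t ht =>
    obtain ⟨A, B, hA, hB, rfl⟩ := ht
    exact hFG A B hA hB
  | compl t ht ih =>
    have huniv := hFG univ univ .univ .univ
    rw [univ_inter, setIntegral_univ, setIntegral_univ] at huniv
    rw [setIntegral_compl (hle _ ht) hF, setIntegral_compl (hle _ ht) hG, ih, huniv]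
  | iUnion t hd ht ih =>
    rw [integral_iUnion (fun i => hle _ (ht i)) hd hF.integrableOn,
      integral_iUnion (fun i => hle _ (ht i)) hd hG.integrableOn]
    exact tsum_congr ih

theorem Indep.condExp_mul [IsFiniteMeasure P] {X Y : Ω → ℝ} (hle₁ : m₁ ≤ m) (hle₂ : m₂ ≤ m)
    (hle₁' : m₁' ≤ m₁) (hle₂' : m₂' ≤ m₂) (hind : Indep m₁ m₂ P)
    (hX : StronglyMeasurable[m₁] X) (hXint : Integrable X P)
    (hY : StronglyMeasurable[m₂] Y) (hYint : Integrable Y P) :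
    P[fun ω => X ω * Y ω | m₁' ⊔ m₂'] =ᵐ[P] fun ω => (P[X | m₁']) ω * (P[Y | m₂']) ω := by
  have hle₁m := hle₁'.trans hle₁
  have hle₂m := hle₂'.trans hle₂
  have hcX : StronglyMeasurable[m₁'] (P[X | m₁']) := stronglyMeasurable_condExp
  have hcY : StronglyMeasurable[m₂'] (P[Y | m₂']) := stronglyMeasurable_condExp
  have hXY := hind.integrable_mul hX hXint hY hYint
  have hcXY := hind.integrable_mul (hcX.mono hle₁') integrable_condExp
    (hcY.mono hle₂') integrable_condExp
  refine (ae_eq_condExp_of_forall_setIntegral_eq (sup_le hle₁m hle₂m) hXY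
    (fun _ _ _ => hcXY.integrableOn)
    (fun s hs _ => setIntegral_eq_of_forall_inter hle₁m hle₂m hcXY hXY ?_ hs) ?_).symm
  · intro A B hA hB
    rw [hind.setIntegral_inter_mul hle₁ hle₂ hX hY (hle₁' _ hA) (hle₂' _ hB),
      hind.setIntegral_inter_mul hle₁ hle₂ (hcX.mono hle₁') (hcY.mono hle₂')
        (hle₁' _ hA) (hle₂' _ hB),
      setIntegral_condExp hle₁m hXint hA, setIntegral_condExp hle₂m hYint hB]
  · exact ((hcX.mono le_sup_left).mul (hcY.mono le_sup_right)).aestronglyMeasurable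

end ProbabilityTheory

/-- Conditional-expectation factorization under independence (Lemma 4.3 of [6], used in
step (b) of the proof of part i3) of Theorem 3.4): if `f` and `h` are `P`-independent,
`f' ⊆ f`, `h' ⊆ h`, `X` is `f`-measurable and `P`-integrable and `Y` is `h`-measurable and
`P`-integrable, then `XY` is `P`-integrable and
`E[XY | f' ∨ h'] = E[X | f'] · E[Y | h']` `P`-a.s. -/
theorem stmt_7 {Ω : Type*} [m0 : MeasurableSpace Ω] (P : @Measure Ω m0)
    [IsProbabilityMeasure P]
    (f h f' h' : MeasurableSpace Ω)
    (hf : f ≤ m0) (hh : h ≤ m0) (hf' : f' ≤ f) (hh' : h' ≤ h)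
    (hIndep : ∀ A B : Set Ω, MeasurableSet[f] A → MeasurableSet[h] B →
      P (A ∩ B) = P A * P B)
    (X Y : Ω → ℝ)
    (hXmeas : StronglyMeasurable[f] X) (hXint : Integrable X P)
    (hYmeas : StronglyMeasurable[h] Y) (hYint : Integrable Y P) :
    Integrable (fun ω => X ω * Y ω) P ∧
    P[fun ω => X ω * Y ω | f' ⊔ h'] =ᵐ[P] fun ω => (P[X | f']) ω * (P[Y | h']) ω := by
  have hind : ProbabilityTheory.Indep f h P :=
    (ProbabilityTheory.Indep_iff f h P).2 hIndep
  exact ⟨hind.integrable_mul hXmeas hXint hYmeas hYint,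
    hind.condExp_mul hf hh hf' hh' hXmeas hXint hYmeas hYint⟩
end
end

section
/- Let F¹, …, F^d be filtrations on (Ω, 𝒜, P) such that the σ-algebras F¹_T, …, F^d_T are mutually P-independent, and for each i ∈ {1, …, d} let Mⁱ be a (P, Fⁱ)-martingale. Then for every t ∈ [0, T] the product ∏_{i=1}^d Mⁱ_t is P-integrable, and the product process (∏_{i=1}^d Mⁱ_t)_{t∈[0,T]} is a (P, G)-martingale, where G = F¹ ∨ ⋯ ∨ F^d is the filtration with G_t the σ-algebra generated by F¹_t ∪ ⋯ ∪ F^d_t. -/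
open MeasureTheory Set

noncomputable section

open ProbabilityTheory

/-- Integrable functions with the same integral over the whole space and over every set of a
generating π-system have the same integral over every measurable set. -/
lemma setIntegral_eq_of_isPiSystem {Ω : Type*} {m m0 : MeasurableSpace Ω} {μ : Measure Ω}
    (hm : m ≤ m0) {f g : Ω → ℝ} (hf : Integrable f μ) (hg : Integrable g μ)
    {S : Set (Set Ω)} (hS : IsPiSystem S) (hgen : m = MeasurableSpace.generateFrom S)
    (huniv : ∫ ω, f ω ∂μ = ∫ ω, g ω ∂μ)
    (hfg : ∀ A ∈ S, ∫ ω in A, f ω ∂μ = ∫ ω in A, g ω ∂μ)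
    (A : Set Ω) (hA : MeasurableSet[m] A) :
    ∫ ω in A, f ω ∂μ = ∫ ω in A, g ω ∂μ := by
  induction A, hA using MeasurableSpace.induction_on_inter hgen hS with
  | empty => simp
  | basic A hA => exact hfg A hA
  | compl A hA ih =>
    rw [setIntegral_compl (hm _ hA) hf, setIntegral_compl (hm _ hA) hg, huniv, ih]
  | iUnion A hdisj hA ih =>
    rw [integral_iUnion (fun i => hm _ (hA i)) hdisj hf.integrableOn,
      integral_iUnion (fun i => hm _ (hA i)) hdisj hg.integrableOn]
    exact tsum_congr ih

/-- Random variables measurable with respect to independent σ-algebras are independent. -/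
lemma iIndepFun_of_iIndep {Ω ι : Type*} {m0 : MeasurableSpace Ω} {μ : Measure Ω}
    {m : ι → MeasurableSpace Ω} (hm : iIndep m μ) {X : ι → Ω → ℝ}
    (hX : ∀ i, Measurable[m i] (X i)) : iIndepFun X μ := by
  rw [iIndepFun_iff_iIndep]
  rw [iIndep_iff] at hm ⊢
  exact fun s A hA => hm s fun i hi => (hX i).comap_le _ (hA i hi)

/-- A finite product of independent integrable random variables is integrable. -/
lemma ProbabilityTheory.iIndepFun.integrable_fun_prod {Ω ι : Type*} [Fintype ι]
    {m0 : MeasurableSpace Ω} {μ : Measure Ω} {X : ι → Ω → ℝ}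
    (hX : iIndepFun X μ) (hint : ∀ i, Integrable (X i) μ) :
    Integrable (fun ω => ∏ i, X i ω) μ := by
  have := hX.isProbabilityMeasure
  have hmeas : ∀ i, AEMeasurable (X i) μ := fun i => (hint i).aemeasurable
  have hprod : Integrable (fun x : ι → ℝ => ∏ i, x i) (μ.map fun ω i => X i ω) := by
    rw [hX.map_fun_eq_pi_map hmeas]
    have (i : ι) : IsProbabilityMeasure (μ.map (X i)) := Measure.isProbabilityMeasure_map (hmeas i)
    exact Integrable.fintype_prod (f := fun _ x => x) fun i =>
      (integrable_map_measure aestronglyMeasurable_id (hmeas i)).2 (hint i)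
  exact hprod.comp_aemeasurable (aemeasurable_pi_lambda _ hmeas)

/-- The integral of a product of independent random variables over an intersection of events
factorizes. -/
lemma setIntegral_iInter_prod {Ω ι : Type*} [Fintype ι] {m0 : MeasurableSpace Ω}
    {μ : Measure Ω} {m : ι → MeasurableSpace Ω} (hle : ∀ i, m i ≤ m0) (hm : iIndep m μ)
    {X : ι → Ω → ℝ} (hX : ∀ i, Measurable[m i] (X i))
    {A : ι → Set Ω} (hA : ∀ i, MeasurableSet[m i] (A i)) :
    ∫ ω in ⋂ i, A i, ∏ i, X i ω ∂μ = ∏ i, ∫ ω in A i, X i ω ∂μ := by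
  have hmeas (i : ι) : Measurable[m i] ((A i).indicator (X i)) := (hX i).indicator (hA i)
  calc
    _ = ∫ ω, ∏ i, (A i).indicator (X i) ω ∂μ := by
      rw [← integral_indicator (.iInter fun i => hle i _ (hA i))]
      congr 1 with ω
      by_cases h : ∀ i, ω ∈ A i
      · simp [h]
      · rw [indicator_of_notMem (by simpa using h)]
        obtain ⟨i, hi⟩ := not_forall.1 h
        exact (Finset.prod_eq_zero (Finset.mem_univ i) (indicator_of_notMem hi _)).symm
    _ = ∏ i, ∫ ω, (A i).indicator (X i) ω ∂μ :=
      (iIndepFun_of_iIndep hm hmeas).integral_fun_prod_eq_prod_integral fun i =>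
        ((hmeas i).mono (hle i) le_rfl).aestronglyMeasurable
    _ = _ := by simp_rw [fun i => integral_indicator (hle i _ (hA i)) (μ := μ) (f := X i)]

/-- Measure-theoretic core of the independence arguments of Theorems 4.1 and 4.2: if the
σ-algebras `F¹_T, …, F^d_T` are mutually `P`-independent and each `Mⁱ` is a
`(P, Fⁱ)`-martingale, then each product `∏ᵢ Mⁱ_t` is `P`-integrable and the product process
`(∏ᵢ Mⁱ_t)` is a `(P, G)`-martingale, where `G = F¹ ∨ ⋯ ∨ F^d`. -/
theorem stmt_8 {Ω : Type*} [m0 : MeasurableSpace Ω] (P : Measure Ω) [IsProbabilityMeasure P]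
    (T : ℝ) (hT : 0 < T)
    {d : ℕ} (F : Fin d → ℝ → MeasurableSpace Ω)
    (hFle : ∀ i t, F i t ≤ m0) (hFmono : ∀ i, Monotone (F i))
    (hIndep : ∀ A : Fin d → Set Ω, (∀ i, MeasurableSet[F i T] (A i)) →
      P (⋂ i, A i) = ∏ i, P (A i))
    (M : Fin d → ℝ → Ω → ℝ)
    (hM : ∀ i, IsMartingaleOn P (F i) T (M i)) :
    (∀ t ∈ Set.Icc (0 : ℝ) T, Integrable (fun ω => ∏ i, M i t ω) P) ∧
    IsMartingaleOn P (fun t => ⨆ i, F i t) T (fun t ω => ∏ i, M i t ω) := by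
  classical
  have hInd : iIndep (fun i => F i T) P := by
    rw [iIndep_iff]
    intro s A hA
    convert hIndep (fun i => if i ∈ s then A i else univ) (fun i => ?_) using 1
    · congr 1
      ext ω
      simp only [mem_iInter]
      exact forall_congr' fun i => by by_cases hi : i ∈ s <;> simp [hi]
    · rw [← Finset.prod_subset (Finset.subset_univ s) fun i _ hi => by simp [hi]]
      exact Finset.prod_congr rfl fun i hi => by simp [hi]
    · split_ifs with hi
      · exact hA i hi
      · exact MeasurableSet.univ
  have hmeas (i : Fin d) {t : ℝ} (ht : t ∈ Icc (0 : ℝ) T) : Measurable[F i T] (M i t) :=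
    (((hM i).1 t ht).1.mono (hFmono i ht.2)).measurable
  have hint (t : ℝ) (ht : t ∈ Icc (0 : ℝ) T) : Integrable (fun ω => ∏ i, M i t ω) P :=
    (iIndepFun_of_iIndep hInd fun i => hmeas i ht).integrable_fun_prod
      fun i => ((hM i).1 t ht).2
  have hsm (t : ℝ) (ht : t ∈ Icc (0 : ℝ) T) :
      StronglyMeasurable[⨆ i, F i t] (fun ω => ∏ i, M i t ω) :=
    Finset.stronglyMeasurable_fun_prod _ fun i _ =>
      ((hM i).1 t ht).1.mono (le_iSup (fun i => F i t) i)
  refine ⟨hint, fun t ht => ⟨hsm t ht, hint t ht⟩, fun s t hs ht hst => ?_⟩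
  have hle : ⨆ i, F i s ≤ m0 := iSup_le fun i => hFle i s
  have hinter (A : Fin d → Set Ω) (hA : ∀ i, MeasurableSet[F i s] (A i)) :
      ∫ ω in ⋂ i, A i, ∏ i, M i s ω ∂P = ∫ ω in ⋂ i, A i, ∏ i, M i t ω ∂P := by
    have hAT (i : Fin d) : MeasurableSet[F i T] (A i) := hFmono i hs.2 _ (hA i)
    rw [setIntegral_iInter_prod (fun i => hFle i T) hInd (fun i => hmeas i hs) hAT,
      setIntegral_iInter_prod (fun i => hFle i T) hInd (fun i => hmeas i ht) hAT]
    refine Finset.prod_congr rfl fun i _ => ?_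
    rw [← setIntegral_condExp (hFle i s) ((hM i).1 t ht).2 (hA i)]
    exact integral_congr_ae (ae_restrict_of_ae ((hM i).2 s t hs ht hst).symm)
  refine (ae_eq_condExp_of_forall_setIntegral_eq hle (hint t ht)
    (fun _ _ _ => (hint s hs).integrableOn) (fun A hA _ => ?_)
    (hsm s hs).aestronglyMeasurable).symm
  refine setIntegral_eq_of_isPiSystem hle (hint s hs) (hint t ht)
    (isPiSystem_piiUnionInter (fun i => {A | MeasurableSet[F i s] A})
      (fun i => @MeasurableSpace.isPiSystem_measurableSet Ω (F i s)) univ)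
    ((generateFrom_piiUnionInter_measurableSet (fun i => F i s) univ).trans (by simp)).symm ?_ ?_ A hA
  · simpa using hinter (fun _ => univ) fun _ => MeasurableSet.univ
  · rintro _ ⟨u, -, B, hB, rfl⟩
    have hBu : ⋂ i ∈ u, B i = ⋂ i, if i ∈ u then B i else univ := by
      ext ω
      simp only [mem_iInter]
      exact forall_congr' fun i => by by_cases hi : i ∈ u <;> simp [hi]
    rw [hBu]
    refine hinter _ fun i => ?_
    split_ifs with hi
    · exact hB i hi
    · exact MeasurableSet.univ
end
end

section
/- Let F be a filtration on (Ω, 𝒜, P) and let M be an F-adapted process that is a (P, F)-martingale. Suppose that P|_{F_T} is the unique probability measure on (Ω, F_T) equivalent to P|_{F_T} under which M is an F-martingale. Then F_0 is P-trivial, i.e., every A ∈ F_0 satisfies P(A) ∈ {0, 1}. -/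
open MeasureTheory Set

noncomputable section

/-- A process is a martingale iff it is adapted, integrable, and its increments integrate to zero
over every set of the past. -/
theorem isMartingaleOn_iff_setIntegral_eq {Ω : Type*} [mΩ : MeasurableSpace Ω] {P : Measure Ω}
    [IsFiniteMeasure P] {F : ℝ → MeasurableSpace Ω} {T : ℝ} {M : ℝ → Ω → ℝ}
    (hF : ∀ t ∈ Icc (0 : ℝ) T, F t ≤ mΩ) :
    IsMartingaleOn P F T M ↔
      (∀ t ∈ Icc (0 : ℝ) T, StronglyMeasurable[F t] (M t) ∧ Integrable (M t) P) ∧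
        ∀ s t, s ∈ Icc (0 : ℝ) T → t ∈ Icc (0 : ℝ) T → s ≤ t →
          ∀ B, MeasurableSet[F s] B → ∫ ω in B, M t ω ∂P = ∫ ω in B, M s ω ∂P := by
  refine and_congr_right fun h => ⟨fun hc s t hs ht hst B hB => ?_, fun hc s t hs ht hst => ?_⟩
  · rw [← setIntegral_condExp (hF s hs) (h t ht).2 hB]
    exact integral_congr_ae (ae_restrict_of_ae (hc s t hs ht hst))
  · exact (ae_eq_condExp_of_forall_setIntegral_eq (hF s hs) (h t ht).2
      (fun _ _ _ => (h s hs).2.integrableOn)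
      (fun B hB _ => (hc s t hs ht hst B hB).symm)
      (h s hs).1.aestronglyMeasurable).symm

namespace IsMartingaleOn

theorem add {Ω : Type*} [mΩ : MeasurableSpace Ω] {P Q : Measure Ω} [IsFiniteMeasure P] [IsFiniteMeasure Q]
    {F : ℝ → MeasurableSpace Ω} {T : ℝ} {M : ℝ → Ω → ℝ} (hF : ∀ t ∈ Icc (0 : ℝ) T, F t ≤ mΩ)
    (hP : IsMartingaleOn P F T M) (hQ : IsMartingaleOn Q F T M) :
    IsMartingaleOn (P + Q) F T M := by
  rw [isMartingaleOn_iff_setIntegral_eq hF] at hP hQ ⊢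
  refine ⟨fun t ht => ⟨(hP.1 t ht).1, (hP.1 t ht).2.add_measure (hQ.1 t ht).2⟩,
    fun s t hs ht hst B hB => ?_⟩
  rw [Measure.restrict_add,
    integral_add_measure (hP.1 t ht).2.integrableOn (hQ.1 t ht).2.integrableOn,
    integral_add_measure (hP.1 s hs).2.integrableOn (hQ.1 s hs).2.integrableOn,
    hP.2 s t hs ht hst B hB, hQ.2 s t hs ht hst B hB]

theorem smul {Ω : Type*} [mΩ : MeasurableSpace Ω] {P : Measure Ω} [IsFiniteMeasure P]
    {F : ℝ → MeasurableSpace Ω} {T : ℝ} {M : ℝ → Ω → ℝ} (hF : ∀ t ∈ Icc (0 : ℝ) T, F t ≤ mΩ)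
    (hP : IsMartingaleOn P F T M) {c : ENNReal} (hc : c ≠ ⊤) :
    IsMartingaleOn (c • P) F T M := by
  have : IsFiniteMeasure (c • P) := Measure.smul_finite P hc
  rw [isMartingaleOn_iff_setIntegral_eq hF] at hP ⊢
  refine ⟨fun t ht => ⟨(hP.1 t ht).1, (hP.1 t ht).2.smul_measure hc⟩,
    fun s t hs ht hst B hB => ?_⟩
  rw [Measure.restrict_smul, integral_smul_measure, integral_smul_measure,
    hP.2 s t hs ht hst B hB]

/-- The martingale property is preserved by restriction to an event of the initial σ-algebra. -/
theorem restrict {Ω : Type*} [mΩ : MeasurableSpace Ω] {P : Measure Ω} [IsFiniteMeasure P]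
    {F : ℝ → MeasurableSpace Ω} {T : ℝ} {M : ℝ → Ω → ℝ} (hF : ∀ t ∈ Icc (0 : ℝ) T, F t ≤ mΩ)
    (hmono : Monotone F) (hP : IsMartingaleOn P F T M) {A : Set Ω} (hA : MeasurableSet[F 0] A) :
    IsMartingaleOn (P.restrict A) F T M := by
  rw [isMartingaleOn_iff_setIntegral_eq hF] at hP ⊢
  refine ⟨fun t ht => ⟨(hP.1 t ht).1, (hP.1 t ht).2.restrict⟩, fun s t hs ht hst B hB => ?_⟩
  rw [Measure.restrict_restrict (hF s hs B hB)]
  exact hP.2 s t hs ht hst (B ∩ A) (hB.inter (hmono hs.1 A hA))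

theorem trim {Ω : Type*} {m mΩ : MeasurableSpace Ω} {P : Measure Ω} [IsFiniteMeasure P]
    {F : ℝ → MeasurableSpace Ω} {T : ℝ} {M : ℝ → Ω → ℝ} (hm : m ≤ mΩ)
    (hF : ∀ t ∈ Icc (0 : ℝ) T, F t ≤ m) (hP : IsMartingaleOn P F T M) :
    IsMartingaleOn (mΩ := m) (P.trim hm) F T M := by
  rw [isMartingaleOn_iff_setIntegral_eq fun t ht => (hF t ht).trans hm] at hP
  rw [isMartingaleOn_iff_setIntegral_eq (mΩ := m) hF]
  have hM : ∀ t ∈ Icc (0 : ℝ) T, StronglyMeasurable[m] (M t) :=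
    fun t ht => (hP.1 t ht).1.mono (hF t ht)
  refine ⟨fun t ht => ⟨(hP.1 t ht).1, (hP.1 t ht).2.trim hm (hM t ht)⟩,
    fun s t hs ht hst B hB => ?_⟩
  rw [← setIntegral_trim hm (hM t ht) (hF s hs B hB),
    ← setIntegral_trim hm (hM s hs) (hF s hs B hB)]
  exact hP.2 s t hs ht hst B hB

/-- If a probability measure `P` is the only martingale measure for `M` in its equivalence class,
then the initial σ-algebra is trivial: for a non-null `A`, the average of `P` and `P` conditioned
on `A` is an equivalent martingale measure, hence equal to `P`, which forces `P A = 1`. -/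
theorem measure_eq_zero_or_one_of_unique {Ω : Type*} [mΩ : MeasurableSpace Ω] {P : Measure Ω}
    [IsProbabilityMeasure P] {F : ℝ → MeasurableSpace Ω} {T : ℝ} {M : ℝ → Ω → ℝ}
    (hF : ∀ t ∈ Icc (0 : ℝ) T, F t ≤ mΩ) (hmono : Monotone F) (hP : IsMartingaleOn P F T M)
    (huniq : ∀ R : Measure Ω, IsProbabilityMeasure R → R ≪ P → P ≪ R →
      IsMartingaleOn R F T M → R = P)
    {A : Set Ω} (hA : MeasurableSet[F 0] A) : P A = 0 ∨ P A = 1 := by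
  refine or_iff_not_imp_left.2 fun hA0 => ?_
  have hAinv : (P A)⁻¹ ≠ ⊤ := ENNReal.inv_ne_top.2 hA0
  have hhalf : (2 : ENNReal)⁻¹ ≠ ⊤ := by simp
  have hmul : (P A)⁻¹ * P A = 1 := ENNReal.inv_mul_cancel hA0 (measure_ne_top P A)
  have hfin : IsFiniteMeasure ((P A)⁻¹ • P.restrict A) := Measure.smul_finite _ hAinv
  have hR := huniq ((2 : ENNReal)⁻¹ • (P + (P A)⁻¹ • P.restrict A))
    ⟨by simp [hmul, ENNReal.inv_two_add_inv_two]⟩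
    (Measure.AbsolutelyContinuous.smul_left
      (Measure.AbsolutelyContinuous.add_left Measure.AbsolutelyContinuous.rfl
        (Measure.absolutelyContinuous_restrict.smul_left _)) _)
    (fun B hB => by simp at hB; exact hB.1)
    ((hP.add hF ((hP.restrict hF hmono hA).smul hF hAinv)).smul hF hhalf)
  have hval := congrArg (fun R : Measure Ω => R.real A) hR
  simp only [Measure.real, Measure.smul_apply, Measure.add_apply, Measure.restrict_apply_self,
    smul_eq_mul, hmul] at hval
  rw [ENNReal.toReal_mul, ENNReal.toReal_add (measure_ne_top P A) ENNReal.one_ne_top] at hval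
  norm_num at hval
  rw [← ENNReal.toReal_eq_one_iff]
  linarith

end IsMartingaleOn

/-- If `P|_{F_T}` is the unique probability measure on `(Ω, F_T)` equivalent to `P|_{F_T}`
under which `M` is an `F`-martingale (hypothesis A1) of the paper), then `F_0` is
`P`-trivial: every `A ∈ F_0` satisfies `P(A) ∈ {0, 1}`. -/
theorem stmt_9 {Ω : Type*} [m0 : MeasurableSpace Ω] (P : Measure Ω) [IsProbabilityMeasure P]
    (T : ℝ) (hT : 0 < T)
    (F : ℝ → MeasurableSpace Ω)
    (hFle : ∀ t, F t ≤ m0) (hFmono : Monotone F)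
    (M : ℝ → Ω → ℝ) (hM : IsMartingaleOn P F T M)
    (huniq : ∀ R : @Measure Ω (F T), IsProbabilityMeasure R →
      R ≪ P.trim (hFle T) → P.trim (hFle T) ≪ R →
      IsMartingaleOn (mΩ := F T) R F T M → R = P.trim (hFle T)) :
    ∀ A : Set Ω, MeasurableSet[F 0] A → P A = 0 ∨ P A = 1 := by
  have hF : ∀ t ∈ Icc (0 : ℝ) T, F t ≤ F T := fun t ht => hFmono ht.2
  intro A hA
  have hAT : MeasurableSet[F T] A := hFmono hT.le A hA
  have : @IsProbabilityMeasure Ω (F T) (P.trim (hFle T)) :=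
    ⟨by rw [trim_measurableSet_eq (hFle T) MeasurableSet.univ, measure_univ]⟩
  rw [← trim_measurableSet_eq (hFle T) hAT]
  exact IsMartingaleOn.measure_eq_zero_or_one_of_unique (mΩ := F T) hF hFmono
    (hM.trim (hFle T) hF) huniq hA
end
end
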